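/- Let 𝐀 be a regular BBL transformation of bandwidth (p,q) on V_d^S, set σ = dτ − dim Ker 𝐀, and for an integer L let F_L^− = {Ψ ∈ M_{L,∞} : (P_{L,∞}T)^k Ψ = 0 for some k ∈ ℕ} be the generalized kernel of the unilateral shift P_{L,∞}T restricted to M_{L,∞}; define analogously F_R^+ = {Ψ ∈ M_{−∞,R} : (P_{−∞,R}T⁻¹)^k Ψ = 0 for some k ∈ ℕ}. Then M_{L,∞} is finite-dimensional, M_{L,∞} = P_{L,∞} Ker 𝐀 ⊕ F_L^−, and F_L^− ⊆ V_{L, L+σ−1}; similarly, M_{−∞,R} = P_{−∞,R} Ker 𝐀 ⊕ F_R^+ and F_R^+ ⊆ V_{R−σ+1, R}. -/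

import Mathlib

noncomputable section

/-- The space of doubly-infinite sequences with values in `ℂ^d`. -/
abbrev SeqSp (d : ℕ) : Type := ℤ → Fin d → ℂ

/-- The shift `(Ψ_j)_j ↦ (Ψ_{j+n})_j`; for `n = 1` this is the left shift `T`. -/
def shiftBy (d : ℕ) (n : ℤ) : Module.End ℂ (SeqSp d) where
  toFun Ψ := fun j => Ψ (j + n)
  map_add' _ _ := rfl
  map_smul' _ _ := rfl

/-- Entrywise multiplication of a sequence by a fixed `d × d` matrix. -/
def matOp (d : ℕ) (m : Matrix (Fin d) (Fin d) ℂ) : Module.End ℂ (SeqSp d) where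
  toFun Ψ := fun j => m.mulVec (Ψ j)
  map_add' Ψ Φ := by funext j; simp [Matrix.mulVec_add]
  map_smul' c Ψ := by funext j; simp [Matrix.mulVec_smul]

/-- The banded block-Laurent (BBL) transformation `(𝐀Ψ)_j = ∑_{r=p}^{q} a_r ψ_{j+r}`. -/
def bbl (d : ℕ) (a : ℤ → Matrix (Fin d) (Fin d) ℂ) (p q : ℤ) : Module.End ℂ (SeqSp d) :=
  ∑ r ∈ Finset.Icc p q, matOp d (a r) * shiftBy d r

/-- The projection `P_S` replacing every entry with index outside `S` by zero. -/
def projOn (d : ℕ) (S : Set ℤ) : Module.End ℂ (SeqSp d) where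
  toFun Ψ := fun j => S.indicator Ψ j
  map_add' Ψ Φ := by
    funext j
    by_cases h : j ∈ S <;> simp [Set.indicator_apply, h]
  map_smul' c Ψ := by
    funext j
    by_cases h : j ∈ S <;> simp [Set.indicator_apply, h]

/-- The window `{j : ℤ | Lb ≤ j ≤ Rb}`, with possibly infinite endpoints. -/
def windowSet (Lb : WithBot ℤ) (Rb : WithTop ℤ) : Set ℤ :=
  {j : ℤ | Lb ≤ (j : WithBot ℤ) ∧ (j : WithTop ℤ) ≤ Rb}

/-- Sequences supported in `S` (vanishing at every index outside `S`): the space `V_{L,R}`. -/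
def suppIn (d : ℕ) (S : Set ℤ) : Submodule ℂ (SeqSp d) where
  carrier := {Ψ | ∀ j ∉ S, Ψ j = 0}
  add_mem' := by
    intro Ψ Φ hΨ hΦ j hj
    simp [Pi.add_apply, hΨ j hj, hΦ j hj]
  zero_mem' := fun j _ => rfl
  smul_mem' := by
    intro c Ψ hΨ j hj
    simp [Pi.smul_apply, hΨ j hj]

/-- Sequences vanishing at every index of `S`. -/
def vanishOn (d : ℕ) (S : Set ℤ) : Submodule ℂ (SeqSp d) where
  carrier := {Ψ | ∀ j ∈ S, Ψ j = 0}
  add_mem' := by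
    intro Ψ Φ hΨ hΦ j hj
    simp [Pi.add_apply, hΨ j hj, hΦ j hj]
  zero_mem' := fun j _ => rfl
  smul_mem' := by
    intro c Ψ hΨ j hj
    simp [Pi.smul_apply, hΨ j hj]

/-- The bulk solution space `M_{Lb,Rb} = Ker (P_{Lb−p',Rb−q'} 𝐀 |_{V_{Lb,Rb}})`, viewed as a
submodule of the full sequence space: sequences supported in the window `[Lb,Rb]` whose image
under `𝐀` vanishes on the bulk window `[Lb−p', Rb−q']` (with `p' = min p 0`, `q' = max q 0`). -/
def bulkSol (d : ℕ) (a : ℤ → Matrix (Fin d) (Fin d) ℂ) (p q : ℤ)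
    (Lb : WithBot ℤ) (Rb : WithTop ℤ) : Submodule ℂ (SeqSp d) :=
  suppIn d (windowSet Lb Rb) ⊓
    (vanishOn d (windowSet (Lb + ((-min p 0 : ℤ) : WithBot ℤ))
        (Rb + ((-max q 0 : ℤ) : WithTop ℤ)))).comap (bbl d a p q)

/-- Falling-factorial type product `j^{(v)} = (j−v+1)(j−v+2)⋯j`. -/
def ff (j : ℤ) (v : ℕ) : ℤ := ∏ i ∈ Finset.range v, (j - i)

/-- The scalar sequence `Φ_{z,v}`, with `j`-th entry `j^{(v−1)} z^{j−v+1}`, and `Φ_{z,0} = 0`. -/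
def Phi (z : ℂ) (v : ℕ) : ℤ → ℂ :=
  fun j => if v = 0 then 0 else (ff j (v - 1) : ℂ) * z ^ (j - (v : ℤ) + 1)

/-- The vector sequence `Φ_{z,v}|m⟩`. -/
def PhiVec (d : ℕ) (z : ℂ) (v : ℕ) (m : Fin d) : SeqSp d :=
  fun j => Phi z v j • (Pi.single m 1 : Fin d → ℂ)

/-- The subspace `T_{z,s} = Span{Φ_{z,v}|m⟩ : 1 ≤ v ≤ s, 1 ≤ m ≤ d}`. -/
def Tspace (d : ℕ) (z : ℂ) (s : ℕ) : Submodule ℂ (SeqSp d) :=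
  Submodule.span ℂ {Ψ : SeqSp d | ∃ v ∈ Finset.Icc 1 s, ∃ m : Fin d, Ψ = PhiVec d z v m}

/-- The symbol `A(w,w⁻¹) = ∑_{r=p}^q w^r a_r` as a matrix of Laurent polynomials. -/
def symbol (d : ℕ) (a : ℤ → Matrix (Fin d) (Fin d) ℂ) (p q : ℤ) :
    Matrix (Fin d) (Fin d) (LaurentPolynomial ℂ) :=
  ∑ r ∈ Finset.Icc p q, (LaurentPolynomial.T r : LaurentPolynomial ℂ) • (a r).map (fun c => LaurentPolynomial.C c)

/-- The evaluation `A(z,z⁻¹) = ∑_{r=p}^q z^r a_r` of the symbol at `z ≠ 0`. -/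
def symbolEval (d : ℕ) (a : ℤ → Matrix (Fin d) (Fin d) ℂ) (p q : ℤ) (z : ℂ) :
    Matrix (Fin d) (Fin d) ℂ :=
  ∑ r ∈ Finset.Icc p q, z ^ r • a r

/-- The `k`-th derivative `A^{(k)}(z,z⁻¹) = ∑_{r=p}^q r(r−1)⋯(r−k+1) z^{r−k} a_r`. -/
def symbolDeriv (d : ℕ) (a : ℤ → Matrix (Fin d) (Fin d) ℂ) (p q : ℤ) (k : ℕ) (z : ℂ) :
    Matrix (Fin d) (Fin d) ℂ :=
  ∑ r ∈ Finset.Icc p q, ((ff r k : ℂ) * z ^ (r - (k : ℤ))) • a r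

/-- The generalized kernel `⋃_k Ker (f^k)` of an endomorphism. -/
def genKer (d : ℕ) (f : Module.End ℂ (SeqSp d)) : Submodule ℂ (SeqSp d) :=
  ⨆ k : ℕ, LinearMap.ker (f ^ k)

/-- `F_L^− `: the generalized kernel of the unilateral shift `P_{L,∞}T` on `M_{L,∞}`. -/
def Fminus (d : ℕ) (a : ℤ → Matrix (Fin d) (Fin d) ℂ) (p q : ℤ) (L : ℤ) :
    Submodule ℂ (SeqSp d) :=
  bulkSol d a p q (L : WithBot ℤ) ⊤ ⊓
    genKer d (projOn d (windowSet (L : WithBot ℤ) ⊤) * shiftBy d 1)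

/-- `F_R^+`: the generalized kernel of the shift `P_{−∞,R}T⁻¹` on `M_{−∞,R}`. -/
def Fplus (d : ℕ) (a : ℤ → Matrix (Fin d) (Fin d) ℂ) (p q : ℤ) (R : ℤ) :
    Submodule ℂ (SeqSp d) :=
  bulkSol d a p q ⊥ (R : WithTop ℤ) ⊓
    genKer d (projOn d (windowSet ⊥ (R : WithTop ℤ)) * shiftBy d (-1))

/-- The left shift on scalar sequences. -/
def shiftS : Module.End ℂ (ℤ → ℂ) where
  toFun φ := fun j => φ (j + 1)
  map_add' _ _ := rfl
  map_smul' _ _ := rfl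

/-- The linear map on `SeqSp d` induced by a diagonal matrix polynomial with diagonal entries
`g m`: it acts on the `m`-th component of a sequence as `g m` evaluated at the left shift. -/
def diagPolyOp (d : ℕ) (g : Fin d → Polynomial ℂ) : Module.End ℂ (SeqSp d) where
  toFun Ψ := fun j m => Polynomial.aeval shiftS (g m) (fun i => Ψ i m) j
  map_add' Ψ Φ := by
    funext j m
    show Polynomial.aeval shiftS (g m) ((fun i => Ψ i m) + (fun i => Φ i m)) j = _
    rw [map_add]
    rfl
  map_smul' c Ψ := by
    funext j m
    show Polynomial.aeval shiftS (g m) (c • (fun i => Ψ i m)) j = _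
    rw [map_smul]
    rfl

/-- The subspace of sequences with values in `Span{|m⟩ : d₀ < m ≤ d}` (the range of `ρ_d(π)`). -/
def piRange (d d₀ : ℕ) : Submodule ℂ (SeqSp d) where
  carrier := {Ψ | ∀ j : ℤ, ∀ m : Fin d, (m : ℕ) < d₀ → Ψ j m = 0}
  add_mem' := by
    intro Ψ Φ hΨ hΦ j m hm
    simp [Pi.add_apply, hΨ j m hm, hΦ j m hm]
  zero_mem' := fun j m _ => rfl
  smul_mem' := by
    intro c Ψ hΨ j m hm
    simp [Pi.smul_apply, hΨ j m hm]

/-- The Hilbert space `H` of square-summable half-infinite sequences, as a subspace of `SeqSp d`: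
sequences vanishing at indices `j ≤ 0` whose restriction to `j ≥ 1` is in `ℓ²`. -/
def Hspace (d : ℕ) : Submodule ℂ (SeqSp d) where
  carrier := {Ψ | (∀ j : ℤ, j ≤ 0 → Ψ j = 0) ∧ Memℓp (fun n : ℕ => Ψ ((n : ℤ) + 1)) 2}
  add_mem' := by
    intro Ψ Φ hΨ hΦ
    refine ⟨fun j hj => by simp [Pi.add_apply, hΨ.1 j hj, hΦ.1 j hj], ?_⟩
    exact hΨ.2.add hΦ.2
  zero_mem' := ⟨fun j _ => rfl, zero_memℓp⟩
  smul_mem' := by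
    intro c Ψ hΨ
    exact ⟨fun j hj => by simp [Pi.smul_apply, hΨ.1 j hj], hΨ.2.const_smul c⟩


lemma bbl_apply (d : ℕ) (a : ℤ → Matrix (Fin d) (Fin d) ℂ) (p q : ℤ) (Ψ : SeqSp d) (j : ℤ) :
    bbl d a p q Ψ j = ∑ r ∈ Finset.Icc p q, (a r).mulVec (Ψ (j + r)) := by
  simp only [bbl, LinearMap.sum_apply, Finset.sum_apply]
  rfl

lemma bbl_shiftBy (d : ℕ) (a : ℤ → Matrix (Fin d) (Fin d) ℂ) (p q n : ℤ) (Ψ : SeqSp d) (j : ℤ) :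
    bbl d a p q (shiftBy d n Ψ) j = bbl d a p q Ψ (j + n) := by
  simp only [bbl_apply]
  refine Finset.sum_congr rfl fun r _ => ?_
  change (a r).mulVec (Ψ (j + r + n)) = _
  rw [add_right_comm]

lemma mem_windowSet_top (L j : ℤ) : j ∈ windowSet (L : WithBot ℤ) ⊤ ↔ L ≤ j := by
  simp [windowSet]

lemma mem_windowSet_bot (R j : ℤ) : j ∈ windowSet ⊥ (R : WithTop ℤ) ↔ j ≤ R := by
  simp [windowSet]

lemma mem_windowSet_coe (L R j : ℤ) :
    j ∈ windowSet (L : WithBot ℤ) (R : WithTop ℤ) ↔ L ≤ j ∧ j ≤ R := by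
  simp [windowSet]

lemma mem_bulkSol_top (d : ℕ) (a : ℤ → Matrix (Fin d) (Fin d) ℂ) (p q L : ℤ) (Ψ : SeqSp d) :
    Ψ ∈ bulkSol d a p q (L : WithBot ℤ) ⊤ ↔
      (∀ j < L, Ψ j = 0) ∧ ∀ j, L - min p 0 ≤ j → bbl d a p q Ψ j = 0 := by
  have h : (L : WithBot ℤ) + ((-min p 0 : ℤ) : WithBot ℤ) = ((L - min p 0 : ℤ) : WithBot ℤ) := by
    rw [sub_eq_add_neg, WithBot.coe_add]
  simp only [bulkSol, Submodule.mem_inf, Submodule.mem_comap, h, WithTop.top_add]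
  change (∀ j ∉ windowSet _ _, _) ∧ (∀ j ∈ windowSet _ _, _) ↔ _
  simp only [mem_windowSet_top, not_le]

lemma mem_bulkSol_bot (d : ℕ) (a : ℤ → Matrix (Fin d) (Fin d) ℂ) (p q R : ℤ) (Ψ : SeqSp d) :
    Ψ ∈ bulkSol d a p q ⊥ (R : WithTop ℤ) ↔
      (∀ j, R < j → Ψ j = 0) ∧ ∀ j ≤ R - max q 0, bbl d a p q Ψ j = 0 := by
  have h : (R : WithTop ℤ) + ((-max q 0 : ℤ) : WithTop ℤ) = ((R - max q 0 : ℤ) : WithTop ℤ) := by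
    rw [sub_eq_add_neg, WithTop.coe_add]
  simp only [bulkSol, Submodule.mem_inf, Submodule.mem_comap, h, WithBot.bot_add]
  change (∀ j ∉ windowSet _ _, _) ∧ (∀ j ∈ windowSet _ _, _) ↔ _
  simp only [mem_windowSet_bot, not_le]

lemma projOn_apply_of_mem (d : ℕ) {S : Set ℤ} (Ψ : SeqSp d) {j : ℤ} (hj : j ∈ S) :
    projOn d S Ψ j = Ψ j :=
  Set.indicator_of_mem hj Ψ

lemma projOn_apply_of_notMem (d : ℕ) {S : Set ℤ} (Ψ : SeqSp d) {j : ℤ} (hj : j ∉ S) :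
    projOn d S Ψ j = 0 :=
  Set.indicator_of_notMem hj Ψ

lemma projOn_mul_shiftBy_pow_apply (d : ℕ) {S : Set ℤ} {e : ℤ} (hS : ∀ j ∈ S, j + e ∈ S) (k : ℕ)
    (Ψ : SeqSp d) {j : ℤ} (hj : j ∈ S) :
    ((projOn d S * shiftBy d e) ^ k) Ψ j = Ψ (j + k * e) := by
  induction k generalizing j with
  | zero => simp
  | succ k ih =>
    rw [pow_succ', Module.End.mul_apply, Module.End.mul_apply, projOn_apply_of_mem d _ hj]
    change ((projOn d S * shiftBy d e) ^ k) Ψ (j + e) = _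
    rw [ih (hS j hj)]
    congr 1
    push_cast
    ring

lemma mem_genKer (d : ℕ) (f : Module.End ℂ (SeqSp d)) (Ψ : SeqSp d) :
    Ψ ∈ genKer d f ↔ ∃ k : ℕ, (f ^ k) Ψ = 0 := by
  rw [genKer, Submodule.mem_iSup_of_directed]
  · simp only [LinearMap.mem_ker]
  · refine Monotone.directed_le fun m n hmn x hx => ?_
    rw [LinearMap.mem_ker] at hx ⊢
    rw [← Nat.sub_add_cancel hmn, pow_add, Module.End.mul_apply, hx, map_zero]

lemma mem_genKer_projOn_mul_shiftBy (d : ℕ) {S : Set ℤ} {e : ℤ} (hS : ∀ j ∈ S, j + e ∈ S)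
    (Ψ : SeqSp d) :
    Ψ ∈ genKer d (projOn d S * shiftBy d e) ↔ ∃ k : ℕ, ∀ j ∈ S, Ψ (j + k * e) = 0 := by
  rw [mem_genKer]
  refine ⟨fun ⟨k, hk⟩ => ⟨k, fun j hj => ?_⟩, fun ⟨k, hk⟩ => ⟨k + 1, funext fun j => ?_⟩⟩
  · rw [← projOn_mul_shiftBy_pow_apply d hS k Ψ hj, hk]
    rfl
  · by_cases hj : j ∈ S
    · rw [projOn_mul_shiftBy_pow_apply d hS _ Ψ hj]
      have := hk (j + e) (hS j hj)
      rw [Pi.zero_apply, ← this]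
      congr 1
      push_cast
      ring
    · rw [pow_succ', Module.End.mul_apply, Module.End.mul_apply, projOn_apply_of_notMem d _ hj]
      rfl

lemma mem_Fminus (d : ℕ) (a : ℤ → Matrix (Fin d) (Fin d) ℂ) (p q L : ℤ) (Ψ : SeqSp d) :
    Ψ ∈ Fminus d a p q L ↔
      Ψ ∈ bulkSol d a p q (L : WithBot ℤ) ⊤ ∧ ∃ k : ℕ, ∀ j, L + k ≤ j → Ψ j = 0 := by
  rw [Fminus, Submodule.mem_inf, mem_genKer_projOn_mul_shiftBy]
  · refine and_congr_right fun _ => exists_congr fun k => ?_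
    simp only [mem_windowSet_top, mul_one]
    refine ⟨fun h j hj => ?_, fun h j hj => h _ (by lia)⟩
    simpa using h (j - k) (by lia)
  · intro j
    simp only [mem_windowSet_top]
    lia

lemma mem_Fplus (d : ℕ) (a : ℤ → Matrix (Fin d) (Fin d) ℂ) (p q R : ℤ) (Ψ : SeqSp d) :
    Ψ ∈ Fplus d a p q R ↔
      Ψ ∈ bulkSol d a p q ⊥ (R : WithTop ℤ) ∧ ∃ k : ℕ, ∀ j ≤ R - k, Ψ j = 0 := by
  rw [Fplus, Submodule.mem_inf, mem_genKer_projOn_mul_shiftBy]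
  · refine and_congr_right fun _ => exists_congr fun k => ?_
    simp only [mem_windowSet_bot, mul_neg, mul_one]
    refine ⟨fun h j hj => ?_, fun h j hj => h _ (by lia)⟩
    simpa using h (j + k) (by lia)
  · intro j
    simp only [mem_windowSet_bot]
    lia

/-- The coefficient sequence `a`, truncated to the band `[p, q]`. -/
def bandCoeff (d : ℕ) (a : ℤ → Matrix (Fin d) (Fin d) ℂ) (p q r : ℤ) :
    Matrix (Fin d) (Fin d) ℂ :=
  if r ∈ Finset.Icc p q then a r else 0

/-- No nonzero finitely supported sequence of row vectors is annihilated by convolution with the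
band coefficients. -/
def RowRegular (d : ℕ) (a : ℤ → Matrix (Fin d) (Fin d) ℂ) (p q : ℤ) : Prop :=
  ∀ (J : Finset ℤ) (v : ℤ → Fin d → ℂ),
    (∀ i n, ∑ j ∈ J, ∑ m, v j m * bandCoeff d a p q (i - j) m n = 0) → ∀ j ∈ J, v j = 0

lemma sum_bandCoeff_mul (d : ℕ) (a : ℤ → Matrix (Fin d) (Fin d) ℂ) (p q j : ℤ) {I : Finset ℤ}
    (hI : ∀ r ∈ Finset.Icc p q, j + r ∈ I) (Ψ : SeqSp d) (m : Fin d) :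
    ∑ i ∈ I, ∑ n, bandCoeff d a p q (i - j) m n * Ψ i n = bbl d a p q Ψ j m := by
  rw [bbl_apply, Finset.sum_apply]
  symm
  refine Finset.sum_of_injOn (fun r => j + r) (by intro x _ y _; simp) (fun r hr => hI r hr) ?_ ?_
  · intro i _ hi
    have : i - j ∉ Finset.Icc p q := fun h => hi ⟨i - j, h, by simp⟩
    simp [bandCoeff, this]
  · intro r hr
    simp only [add_sub_cancel_left, bandCoeff, if_pos hr]
    rfl

lemma symbol_apply (d : ℕ) (a : ℤ → Matrix (Fin d) (Fin d) ℂ) (p q : ℤ) (m n : Fin d) :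
    symbol d a p q m n = ∑ r ∈ Finset.Icc p q, AddMonoidAlgebra.single r (a r m n) := by
  rw [symbol, Matrix.sum_apply]
  refine Finset.sum_congr rfl fun r _ => ?_
  rw [LaurentPolynomial.single_eq_C_mul_T, mul_comm]
  rfl

lemma rowRegular_of_det_ne_zero (d : ℕ) (a : ℤ → Matrix (Fin d) (Fin d) ℂ) (p q : ℤ)
    (h : (symbol d a p q).det ≠ 0) : RowRegular d a p q := by
  intro J v hv
  let w : Fin d → LaurentPolynomial ℂ := fun m => ∑ j ∈ J, AddMonoidAlgebra.single j (v j m)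
  have hw : w = 0 := by
    refine Matrix.eq_zero_of_vecMul_eq_zero h (funext fun n => ?_)
    ext i
    refine Eq.trans ?_ (hv i n)
    simp only [Matrix.vecMul, dotProduct, w, symbol_apply, Finset.sum_mul_sum,
      AddMonoidAlgebra.single_mul_single, AddMonoidAlgebra.coeff_sum, Finsupp.finsetSum_apply,
      AddMonoidAlgebra.coeff_single, Finsupp.single_apply]
    rw [Finset.sum_comm]
    refine Finset.sum_congr rfl fun j _ => Finset.sum_congr rfl fun m _ => ?_
    have hr (r : ℤ) : j + r = i ↔ i - j = r := by lia
    simp only [hr, Finset.sum_ite_eq, bandCoeff]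
    split_ifs <;> simp
  intro j hj
  funext m
  have := congrArg (fun f : LaurentPolynomial ℂ => f.coeff j) (congrFun hw m)
  simpa only [w, AddMonoidAlgebra.coeff_sum, Finsupp.finsetSum_apply, AddMonoidAlgebra.coeff_single,
    Finsupp.single_apply, Finset.sum_ite_eq', if_pos hj, Pi.zero_apply,
    AddMonoidAlgebra.coeff_zero, Finsupp.coe_zero] using this

lemma RowRegular.neg {d : ℕ} {a : ℤ → Matrix (Fin d) (Fin d) ℂ} {p q : ℤ}
    (h : RowRegular d a p q) : RowRegular d (fun r => a (-r)) (-q) (-p) := by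
  intro J v hv j hj
  have key := h (J.map (Equiv.neg ℤ).toEmbedding) (fun j => v (-j)) ?_ (-j) (by simpa using hj)
  · simpa using key
  · intro i n
    rw [← hv (-i) n, Finset.sum_map]
    refine Finset.sum_congr rfl fun j _ => Finset.sum_congr rfl fun m _ => ?_
    have hb : bandCoeff d (fun r => a (-r)) (-q) (-p) (-i - j) = bandCoeff d a p q (i + j) := by
      have e : -(-i - j) = i + j := by ring
      have h2 : -i - j ∈ Finset.Icc (-q) (-p) ↔ i + j ∈ Finset.Icc p q := by
        simp only [Finset.mem_Icc]
        lia
      simp only [bandCoeff, h2, e]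
    simp [hb]

lemma exists_eq_bot_of_antitone {V : Type*} [AddCommGroup V] [Module ℂ V] [IsArtinian ℂ V]
    (f : ℕ → Submodule ℂ V) (hf : Antitone f) (h : ∀ x, (∀ n, x ∈ f n) → x = 0) :
    ∃ n, f n = ⊥ := by
  obtain ⟨n, hn⟩ := IsArtinian.monotone_stabilizes (⟨f, hf⟩ : ℕ →o (Submodule ℂ V)ᵒᵈ)
  refine ⟨n, (Submodule.eq_bot_iff _).2 fun x hx => h x fun m => ?_⟩
  rcases le_total n m with hnm | hmn
  · have : f n = f m := hn m hnm
    rwa [← this]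
  · exact hf hmn hx

lemma finrank_le_of_le_bulkSol_top {d : ℕ} {a : ℤ → Matrix (Fin d) (Fin d) ℂ} {p q : ℤ}
    (hreg : RowRegular d a p q) (L : ℤ) (U : Submodule ℂ (SeqSp d)) [FiniteDimensional ℂ U]
    (hU : U ≤ bulkSol d a p q (L : WithBot ℤ) ⊤) :
    Module.finrank ℂ U ≤ d * (max q 0 - min p 0).toNat := by
  let res (N : ℕ) : U →ₗ[ℂ] (↥(Finset.Ico L (L + N)) × Fin d → ℂ) :=
    { toFun := fun x c => x.1 c.1 c.2
      map_add' := fun _ _ => rfl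
      map_smul' := fun _ _ => rfl }
  obtain ⟨N, hN⟩ := exists_eq_bot_of_antitone (fun N => LinearMap.ker (res N))
    (by
      intro M N hMN x hx
      funext ⟨⟨i, hi⟩, m⟩
      rw [Finset.mem_Ico] at hi
      exact congrFun (LinearMap.mem_ker.1 hx) (⟨i, Finset.mem_Ico.2 (by lia)⟩, m))
    (by
      intro x hx
      ext i m
      rcases lt_or_ge i L with hi | hi
      · exact congrFun (((mem_bulkSol_top ..).1 (hU x.2)).1 i hi) m
      · exact congrFun (LinearMap.mem_ker.1 (hx (i - L + 1).toNat))
          (⟨i, Finset.mem_Ico.2 (by lia)⟩, m))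
  set t := (max q 0 - min p 0).toNat with ht
  let I := Finset.Ico L (L + (N + t : ℕ))
  let J := Finset.Ico (L - min p 0) (L - min p 0 + N)
  have hJI : ∀ j ∈ J, ∀ r ∈ Finset.Icc p q, j + r ∈ I := by
    simp only [I, J, Finset.mem_Ico, Finset.mem_Icc]
    lia
  have hinj : Function.Injective (res (N + t)) := by
    rw [← LinearMap.ker_eq_bot, eq_bot_iff, ← hN]
    intro x hx
    funext ⟨⟨i, hi⟩, m⟩
    rw [Finset.mem_Ico] at hi
    exact congrFun (LinearMap.mem_ker.1 hx) (⟨i, Finset.mem_Ico.2 (by lia)⟩, m)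
  let C : Matrix (↥J × Fin d) (↥I × Fin d) ℂ :=
    Matrix.of fun jm i => bandCoeff d a p q (i.1 - jm.1) jm.2 i.2
  have hker : LinearMap.range (res (N + t)) ≤ LinearMap.ker C.mulVecLin := by
    rintro _ ⟨x, rfl⟩
    funext ⟨⟨j, hj⟩, m⟩
    have h0 := congrFun (((mem_bulkSol_top ..).1 (hU x.2)).2 j (Finset.mem_Ico.1 hj).1) m
    rw [← sum_bandCoeff_mul d a p q j (hJI j hj)] at h0
    rw [← Finset.sum_coe_sort] at h0
    change ∑ i : ↥I × Fin d, bandCoeff d a p q (i.1 - j) m i.2 * x.1 i.1 i.2 = 0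
    rw [Fintype.sum_prod_type]
    exact h0
  have hrows : LinearIndependent ℂ C.row := by
    rw [← Matrix.vecMul_injective_iff]
    refine (injective_iff_map_eq_zero (Matrix.vecMulLinear C)).2 fun v hv => ?_
    let v' : ℤ → Fin d → ℂ := fun j m => if h : j ∈ J then v (⟨j, h⟩, m) else 0
    have hv' := hreg J v' fun i n => by
      by_cases hi : i ∈ I
      · refine Eq.trans ?_ (congrFun hv (⟨i, hi⟩, n))
        change _ = ∑ jm : ↥J × Fin d, v jm * bandCoeff d a p q (i - jm.1) jm.2 n
        rw [Fintype.sum_prod_type, ← Finset.sum_coe_sort]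
        refine Finset.sum_congr rfl fun j _ => Finset.sum_congr rfl fun m _ => ?_
        simp [v']
      · refine Finset.sum_eq_zero fun j hj => Finset.sum_eq_zero fun m _ => ?_
        have : i - j ∉ Finset.Icc p q := fun h => hi (by simpa using hJI j hj _ h)
        simp [bandCoeff, this]
    funext ⟨⟨j, hj⟩, m⟩
    simpa [v', hj] using congrFun (hv' j hj) m
  have hrank := hrows.rank_matrix
  have hsum := LinearMap.finrank_range_add_finrank_ker C.mulVecLin
  have hle := Submodule.finrank_mono hker
  rw [LinearMap.finrank_range_of_inj hinj] at hle
  rw [Matrix.rank] at hrank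
  simp only [hrank, Module.finrank_fintype_fun_eq_card, Fintype.card_prod, Fintype.card_coe,
    Fintype.card_fin, I, J, Int.card_Ico, add_sub_cancel_left, Int.toNat_natCast] at hsum
  linarith

lemma finiteDimensional_bulkSol_top {d : ℕ} {a : ℤ → Matrix (Fin d) (Fin d) ℂ} {p q : ℤ}
    (hreg : RowRegular d a p q) (L : ℤ) :
    FiniteDimensional ℂ (bulkSol d a p q (L : WithBot ℤ) ⊤) := by
  have h : Module.rank ℂ (bulkSol d a p q (L : WithBot ℤ) ⊤) ≤
      (d * (max q 0 - min p 0).toNat : ℕ) := by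
    refine rank_le fun s hs => ?_
    have hs' : LinearIndependent ℂ fun i : s => (i.1 : SeqSp d) :=
      hs.map' (Submodule.subtype _) (Submodule.ker_subtype _)
    have := FiniteDimensional.span_of_finite ℂ (Set.finite_range fun i : s => (i.1 : SeqSp d))
    have := finrank_le_of_le_bulkSol_top hreg L
      (Submodule.span ℂ (Set.range fun i : s => (i.1 : SeqSp d)))
      (Submodule.span_le.2 (by rintro _ ⟨i, rfl⟩; exact i.1.2))
    rwa [finrank_span_eq_card hs', Fintype.card_coe] at this
  exact Module.rank_lt_aleph0_iff.1 (h.trans_lt (Cardinal.natCast_lt_aleph0))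

/-- The reflection `(Ψ_j)_j ↦ (Ψ_{-j})_j`. -/
def reflect (d : ℕ) : SeqSp d ≃ₗ[ℂ] SeqSp d :=
  LinearEquiv.funCongrLeft ℂ (Fin d → ℂ) (Equiv.neg ℤ)

lemma reflect_apply (d : ℕ) (Ψ : SeqSp d) (j : ℤ) : reflect d Ψ j = Ψ (-j) := rfl

lemma reflect_symm (d : ℕ) : (reflect d).symm = reflect d := rfl

lemma bbl_reflect (d : ℕ) (a : ℤ → Matrix (Fin d) (Fin d) ℂ) (p q : ℤ) (Ψ : SeqSp d) (j : ℤ) :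
    bbl d (fun r => a (-r)) (-q) (-p) (reflect d Ψ) j = bbl d a p q Ψ (-j) := by
  simp only [bbl_apply, reflect_apply]
  refine Finset.sum_nbij' (fun r => -r) (fun r => -r) ?_ ?_ ?_ ?_ ?_
  · simp only [Finset.mem_Icc]; lia
  · simp only [Finset.mem_Icc]; lia
  · simp
  · simp
  · intro r _
    rw [neg_add]

lemma map_reflect_bulkSol (d : ℕ) (a : ℤ → Matrix (Fin d) (Fin d) ℂ) (p q R : ℤ) :
    (bulkSol d (fun r => a (-r)) (-q) (-p) ((-R : ℤ) : WithBot ℤ) ⊤).map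
      (reflect d : SeqSp d →ₗ[ℂ] SeqSp d) = bulkSol d a p q ⊥ (R : WithTop ℤ) := by
  ext Ψ
  rw [Submodule.mem_map_equiv, reflect_symm, mem_bulkSol_top, mem_bulkSol_bot]
  simp only [bbl_reflect, reflect_apply]
  refine and_congr ⟨fun h j hj => ?_, fun h j hj => h _ (by lia)⟩
    ⟨fun h j hj => ?_, fun h j hj => h _ (by lia)⟩
  · simpa using h (-j) (by lia)
  · simpa using h (-j) (by lia)

lemma map_reflect_ker (d : ℕ) (a : ℤ → Matrix (Fin d) (Fin d) ℂ) (p q : ℤ) :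
    (LinearMap.ker (bbl d (fun r => a (-r)) (-q) (-p))).map
      (reflect d : SeqSp d →ₗ[ℂ] SeqSp d) = LinearMap.ker (bbl d a p q) := by
  ext Ψ
  rw [Submodule.mem_map_equiv, reflect_symm, LinearMap.mem_ker, LinearMap.mem_ker]
  constructor
  · intro h
    funext j
    simpa [bbl_reflect] using congrFun h (-j)
  · intro h
    funext j
    rw [bbl_reflect, h]
    rfl

lemma map_reflect_Fminus (d : ℕ) (a : ℤ → Matrix (Fin d) (Fin d) ℂ) (p q R : ℤ) :
    (Fminus d (fun r => a (-r)) (-q) (-p) (-R)).map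
      (reflect d : SeqSp d →ₗ[ℂ] SeqSp d) = Fplus d a p q R := by
  ext Ψ
  rw [mem_Fplus, ← map_reflect_bulkSol, Submodule.mem_map_equiv, Submodule.mem_map_equiv,
    reflect_symm, mem_Fminus]
  refine and_congr_right fun _ => exists_congr fun k => ?_
  simp only [reflect_apply]
  refine ⟨fun h j hj => ?_, fun h j hj => h _ (by lia)⟩
  simpa using h (-j) (by lia)

lemma map_reflect_map_projOn (d : ℕ) (R : ℤ) (K : Submodule ℂ (SeqSp d)) :
    (K.map (projOn d (windowSet ((-R : ℤ) : WithBot ℤ) ⊤))).map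
        (reflect d : SeqSp d →ₗ[ℂ] SeqSp d) =
      (K.map (reflect d : SeqSp d →ₗ[ℂ] SeqSp d)).map (projOn d (windowSet ⊥ (R : WithTop ℤ))) := by
  rw [← Submodule.map_comp, ← Submodule.map_comp]
  congr 1
  refine LinearMap.ext fun Ψ => funext fun j => ?_
  change projOn d _ Ψ (-j) = projOn d _ (reflect d Ψ) j
  by_cases hj : j ≤ R
  · rw [projOn_apply_of_mem d _ ((mem_windowSet_bot R j).2 hj),
      projOn_apply_of_mem d _ ((mem_windowSet_top _ _).2 (by lia)), reflect_apply]
  · rw [projOn_apply_of_notMem d _ (by rw [mem_windowSet_top]; lia),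
      projOn_apply_of_notMem d _ (by rwa [mem_windowSet_bot])]

lemma finiteDimensional_bulkSol_bot {d : ℕ} {a : ℤ → Matrix (Fin d) (Fin d) ℂ} {p q : ℤ}
    (hreg : RowRegular d a p q) (R : ℤ) :
    FiniteDimensional ℂ (bulkSol d a p q ⊥ (R : WithTop ℤ)) := by
  have := finiteDimensional_bulkSol_top hreg.neg (-R)
  rw [← map_reflect_bulkSol]
  infer_instance

lemma bbl_congr {d : ℕ} {a : ℤ → Matrix (Fin d) (Fin d) ℂ} {p q : ℤ} {Ψ Φ : SeqSp d} {i j : ℤ}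
    (h : ∀ r ∈ Finset.Icc p q, Ψ (i + r) = Φ (j + r)) : bbl d a p q Ψ i = bbl d a p q Φ j := by
  rw [bbl_apply, bbl_apply]
  exact Finset.sum_congr rfl fun r hr => by rw [h r hr]

lemma projOn_mem_bulkSol_top {d : ℕ} {a : ℤ → Matrix (Fin d) (Fin d) ℂ} {p q : ℤ} {Ψ : SeqSp d}
    (hΨ : Ψ ∈ LinearMap.ker (bbl d a p q)) (L : ℤ) :
    projOn d (windowSet (L : WithBot ℤ) ⊤) Ψ ∈ bulkSol d a p q (L : WithBot ℤ) ⊤ := by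
  refine (mem_bulkSol_top ..).2 ⟨fun j hj => projOn_apply_of_notMem d _ ?_, fun j hj => ?_⟩
  · rwa [mem_windowSet_top, not_le]
  · refine (bbl_congr fun r hr => projOn_apply_of_mem d _ ?_).trans
      (congrFun (LinearMap.mem_ker.1 hΨ) j)
    rw [mem_windowSet_top]
    rw [Finset.mem_Icc] at hr
    lia

lemma projOn_mem_bulkSol_bot {d : ℕ} {a : ℤ → Matrix (Fin d) (Fin d) ℂ} {p q : ℤ} {Ψ : SeqSp d}
    (hΨ : Ψ ∈ LinearMap.ker (bbl d a p q)) (R : ℤ) :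
    projOn d (windowSet ⊥ (R : WithTop ℤ)) Ψ ∈ bulkSol d a p q ⊥ (R : WithTop ℤ) := by
  refine (mem_bulkSol_bot ..).2 ⟨fun j hj => projOn_apply_of_notMem d _ ?_, fun j hj => ?_⟩
  · rwa [mem_windowSet_bot, not_le]
  · refine (bbl_congr fun r hr => projOn_apply_of_mem d _ ?_).trans
      (congrFun (LinearMap.mem_ker.1 hΨ) j)
    rw [mem_windowSet_bot]
    rw [Finset.mem_Icc] at hr
    lia

lemma finiteDimensional_ker_bbl {d : ℕ} {a : ℤ → Matrix (Fin d) (Fin d) ℂ} {p q : ℤ}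
    (hreg : RowRegular d a p q) : FiniteDimensional ℂ (LinearMap.ker (bbl d a p q)) := by
  have h1 := finiteDimensional_bulkSol_top hreg 0
  have h2 := finiteDimensional_bulkSol_bot hreg (-1)
  refine Submodule.finiteDimensional_of_le
    (S₂ := bulkSol d a p q ((0 : ℤ) : WithBot ℤ) ⊤ ⊔ bulkSol d a p q ⊥ ((-1 : ℤ) : WithTop ℤ)) ?_
  intro Ψ hΨ
  refine Submodule.mem_sup.2
    ⟨_, projOn_mem_bulkSol_top hΨ 0, _, projOn_mem_bulkSol_bot hΨ (-1), funext fun j => ?_⟩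
  rw [Pi.add_apply]
  rcases lt_or_ge j 0 with hj | hj
  · rw [projOn_apply_of_notMem d _ (by rw [mem_windowSet_top]; lia),
      projOn_apply_of_mem d _ (by rw [mem_windowSet_bot]; lia), zero_add]
  · rw [projOn_apply_of_mem d _ (by rwa [mem_windowSet_top]),
      projOn_apply_of_notMem d _ (by rw [mem_windowSet_bot]; lia), add_zero]

/-- Elements of `Ker 𝐀` are determined by their restriction to a right half-line. -/
lemma eq_zero_of_mem_ker_bbl {d : ℕ} {a : ℤ → Matrix (Fin d) (Fin d) ℂ} {p q : ℤ}
    (hreg : RowRegular d a p q) {L : ℤ} {Ψ : SeqSp d} (hΨ : Ψ ∈ LinearMap.ker (bbl d a p q))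
    (h0 : ∀ j, L ≤ j → Ψ j = 0) : Ψ = 0 := by
  have := finiteDimensional_ker_bbl hreg
  obtain ⟨n, hn⟩ := exists_eq_bot_of_antitone
    (fun n : ℕ => (vanishOn d (Set.Ici (L - n))).comap (LinearMap.ker (bbl d a p q)).subtype)
    (fun m n hmn x hx j hj => hx j (by rw [Set.mem_Ici] at hj ⊢; lia))
    (fun x hx => Subtype.ext (funext fun j => hx (L - j).toNat j (by rw [Set.mem_Ici]; lia)))
  have hs : shiftBy d n Ψ ∈ LinearMap.ker (bbl d a p q) :=
    LinearMap.mem_ker.2 (funext fun j => by rw [bbl_shiftBy, LinearMap.mem_ker.1 hΨ]; rfl)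
  have hmem : (⟨shiftBy d n Ψ, hs⟩ : LinearMap.ker (bbl d a p q)) ∈
      (vanishOn d (Set.Ici (L - n))).comap (LinearMap.ker (bbl d a p q)).subtype :=
    fun j hj => h0 (j + n) (by rw [Set.mem_Ici] at hj; lia)
  have hz := congrArg Subtype.val ((Submodule.eq_bot_iff _).1 hn _ hmem)
  funext j
  refine Eq.trans ?_ (congrFun hz (j - n))
  exact congrArg Ψ (sub_add_cancel j (n : ℤ)).symm

/-- The unilateral shift `P_{L,∞} T`. -/
def rightShift (d : ℕ) (L : ℤ) : Module.End ℂ (SeqSp d) :=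
  projOn d (windowSet (L : WithBot ℤ) ⊤) * shiftBy d 1

lemma rightShift_pow_apply (d : ℕ) {L j : ℤ} (hj : L ≤ j) (k : ℕ) (Ψ : SeqSp d) :
    (rightShift d L ^ k) Ψ j = Ψ (j + k) := by
  rw [rightShift, projOn_mul_shiftBy_pow_apply, mul_one]
  · intro i
    simp only [mem_windowSet_top]
    lia
  · rwa [mem_windowSet_top]

lemma rightShift_apply (d : ℕ) {L j : ℤ} (hj : L ≤ j) (Ψ : SeqSp d) :
    rightShift d L Ψ j = Ψ (j + 1) := by
  simpa using rightShift_pow_apply d hj 1 Ψ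

lemma rightShift_mem_bulkSol {d : ℕ} {a : ℤ → Matrix (Fin d) (Fin d) ℂ} {p q L : ℤ} :
    ∀ Ψ ∈ bulkSol d a p q (L : WithBot ℤ) ⊤,
      rightShift d L Ψ ∈ bulkSol d a p q (L : WithBot ℤ) ⊤ := by
  intro Ψ hΨ
  refine (mem_bulkSol_top ..).2 ⟨fun j hj => projOn_apply_of_notMem d _ ?_, fun j hj => ?_⟩
  · rwa [mem_windowSet_top, not_le]
  · refine (bbl_congr (j := j + 1) (Φ := Ψ) fun r hr => ?_).trans
      (((mem_bulkSol_top ..).1 hΨ).2 (j + 1) (by lia))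
    rw [Finset.mem_Icc] at hr
    rw [rightShift_apply d (by lia), add_right_comm]

lemma rightShift_mem_Fminus {d : ℕ} {a : ℤ → Matrix (Fin d) (Fin d) ℂ} {p q L : ℤ} :
    ∀ Ψ ∈ Fminus d a p q L, rightShift d L Ψ ∈ Fminus d a p q L := by
  intro Ψ hΨ
  rw [mem_Fminus] at hΨ ⊢
  obtain ⟨hM, k, hk⟩ := hΨ
  exact ⟨rightShift_mem_bulkSol _ hM, k, fun j hj => by
    rw [rightShift_apply d (by lia), hk _ (by lia)]⟩

lemma injective_projOn_domRestrict_ker_bbl {d : ℕ} {a : ℤ → Matrix (Fin d) (Fin d) ℂ} {p q : ℤ}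
    (hreg : RowRegular d a p q) (L : ℤ) :
    Function.Injective ((projOn d (windowSet (L : WithBot ℤ) ⊤)).domRestrict
      (LinearMap.ker (bbl d a p q))) := by
  refine (injective_iff_map_eq_zero _).2 fun Ψ hΨ => Subtype.ext ?_
  refine eq_zero_of_mem_ker_bbl hreg (L := L) Ψ.2 fun j hj => ?_
  rw [← projOn_apply_of_mem d Ψ.1 ((mem_windowSet_top L j).2 hj)]
  exact congrFun hΨ j

lemma disjoint_map_projOn_ker_Fminus {d : ℕ} {a : ℤ → Matrix (Fin d) (Fin d) ℂ} {p q : ℤ}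
    (hreg : RowRegular d a p q) (L : ℤ) :
    Disjoint ((LinearMap.ker (bbl d a p q)).map (projOn d (windowSet (L : WithBot ℤ) ⊤)))
      (Fminus d a p q L) := by
  rw [Submodule.disjoint_def]
  rintro _ ⟨Ψ, hΨ, rfl⟩ hF
  obtain ⟨-, k, hk⟩ := (mem_Fminus ..).1 hF
  have h0 : Ψ = 0 := eq_zero_of_mem_ker_bbl hreg hΨ (L := L + k) fun j hj => by
    rw [← hk j hj, projOn_apply_of_mem d _ ((mem_windowSet_top L j).2 (by lia))]
  rw [h0, map_zero]

/-- A half-infinite bulk solution with an infinite backward orbit under the unilateral shift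
extends to an element of `Ker 𝐀`. -/
lemma mem_map_projOn_ker_of_backward_orbit {d : ℕ} {a : ℤ → Matrix (Fin d) (Fin d) ℂ} {p q L : ℤ}
    {y : ℕ → SeqSp d} (hy : ∀ n, y n ∈ bulkSol d a p q (L : WithBot ℤ) ⊤)
    (hstep : ∀ n, rightShift d L (y (n + 1)) = y n) :
    y 0 ∈ (LinearMap.ker (bbl d a p q)).map (projOn d (windowSet (L : WithBot ℤ) ⊤)) := by
  have hpow (k n : ℕ) : ∀ j, L ≤ j → y n j = y (n + k) (j + k) := by
    induction k with
    | zero => simp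
    | succ k ih =>
      intro j hj
      rw [ih j hj, ← hstep (n + k), rightShift_apply d (by lia)]
      push_cast
      rw [add_assoc, add_assoc]
  let Ψ : SeqSp d := fun j => y (L - j).toNat (j + (L - j).toNat)
  have hΨ (n : ℕ) (j : ℤ) (hj : L ≤ j + n) : Ψ j = y n (j + n) := by
    have hle : (L - j).toNat ≤ n := by lia
    obtain ⟨k, rfl⟩ := Nat.exists_eq_add_of_le hle
    have := hpow k (L - j).toNat (j + (L - j).toNat) (by lia)
    rw [Nat.cast_add, ← add_assoc]
    exact this
  refine ⟨Ψ, LinearMap.mem_ker.2 (funext fun j => ?_), funext fun j => ?_⟩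
  · let n := (L - min p 0 - j).toNat
    refine (bbl_congr (j := j + n) (Φ := y n) fun r hr => ?_).trans
      (((mem_bulkSol_top ..).1 (hy n)).2 (j + n) (by lia))
    rw [Finset.mem_Icc] at hr
    rw [hΨ n (j + r) (by lia), add_right_comm]
  · by_cases hj : L ≤ j
    · rw [projOn_apply_of_mem d _ ((mem_windowSet_top L j).2 hj), hΨ 0 j (by lia)]
      simp
    · rw [projOn_apply_of_notMem d _ (by rwa [mem_windowSet_top]),
        ((mem_bulkSol_top ..).1 (hy 0)).1 j (by lia)]

lemma exists_map_eq_of_mem_iInf_range_pow {V : Type*} [AddCommGroup V] [Module ℂ V]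
    [FiniteDimensional ℂ V] (g : Module.End ℂ V) {x : V}
    (hx : x ∈ ⨅ n : ℕ, LinearMap.range (g ^ n)) :
    ∃ y ∈ ⨅ n : ℕ, LinearMap.range (g ^ n), g y = x := by
  obtain ⟨N, hN⟩ := Filter.eventually_atTop.1 g.eventually_iInf_range_pow_eq
  obtain ⟨z, rfl⟩ := (Submodule.mem_iInf _).1 hx (N + 1)
  exact ⟨(g ^ N) z, by rw [hN N le_rfl]; exact ⟨z, rfl⟩, by rw [pow_succ']; rfl⟩

lemma bulkSol_top_eq_sup {d : ℕ} {a : ℤ → Matrix (Fin d) (Fin d) ℂ} {p q : ℤ}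
    (hreg : RowRegular d a p q) (L : ℤ) :
    bulkSol d a p q (L : WithBot ℤ) ⊤
      = (LinearMap.ker (bbl d a p q)).map (projOn d (windowSet (L : WithBot ℤ) ⊤))
        ⊔ Fminus d a p q L := by
  refine le_antisymm (fun Ψ hΨ => ?_) (sup_le ?_ inf_le_left)
  · have := finiteDimensional_bulkSol_top hreg L
    let g : Module.End ℂ (bulkSol d a p q (L : WithBot ℤ) ⊤) :=
      (rightShift d L).restrict rightShift_mem_bulkSol
    have htop : (⟨Ψ, hΨ⟩ : bulkSol d a p q (L : WithBot ℤ) ⊤) ∈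
        (⨆ n : ℕ, LinearMap.ker (g ^ n)) ⊔ ⨅ n : ℕ, LinearMap.range (g ^ n) := by
      rw [g.isCompl_iSup_ker_pow_iInf_range_pow.sup_eq_top]
      trivial
    obtain ⟨u, hu, v, hv, huv⟩ := Submodule.mem_sup.1 htop
    rw [sup_comm]
    refine Submodule.mem_sup.2 ⟨u, ?_, v, ?_, congrArg Subtype.val huv⟩
    · have hmap : (⨆ n : ℕ, LinearMap.ker (g ^ n)).map (Submodule.subtype _) ≤
          genKer d (rightShift d L) := by
        rw [Submodule.map_iSup]
        refine iSup_mono fun n => ?_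
        rintro _ ⟨x, hx, rfl⟩
        rw [SetLike.mem_coe, LinearMap.mem_ker, Module.End.pow_restrict] at hx
        exact congrArg Subtype.val hx
      exact ⟨u.2, hmap ⟨u, hu, rfl⟩⟩
    · have hex (y : ↥(⨅ n : ℕ, LinearMap.range (g ^ n))) :
          ∃ y' : ↥(⨅ n : ℕ, LinearMap.range (g ^ n)), g y' = y := by
        obtain ⟨y', hy', h⟩ := exists_map_eq_of_mem_iInf_range_pow g y.2
        exact ⟨⟨y', hy'⟩, h⟩
      choose s hs using hex
      refine mem_map_projOn_ker_of_backward_orbit (y := fun n => ((s^[n] ⟨v, hv⟩).1 : SeqSp d))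
        (fun n => Subtype.property _) fun n => ?_
      rw [Function.iterate_succ_apply']
      exact congrArg Subtype.val (hs _)
  · rintro _ ⟨Φ, hΦ, rfl⟩
    exact projOn_mem_bulkSol_top hΦ L

lemma finrank_Fminus_le {d : ℕ} {a : ℤ → Matrix (Fin d) (Fin d) ℂ} {p q : ℤ}
    (hreg : RowRegular d a p q) (L : ℤ) :
    (Module.finrank ℂ (Fminus d a p q L) : ℤ) ≤ d * (max q 0 - min p 0)
        - Module.finrank ℂ ↥(LinearMap.ker (bbl d a p q)) := by
  have := finiteDimensional_bulkSol_top hreg L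
  have := finiteDimensional_ker_bbl hreg
  have : FiniteDimensional ℂ (Fminus d a p q L) :=
    Submodule.finiteDimensional_of_le (S₂ := bulkSol d a p q (L : WithBot ℤ) ⊤) inf_le_left
  have hle := finrank_le_of_le_bulkSol_top hreg L _ le_rfl
  have hadd := Submodule.finrank_sup_add_finrank_inf_eq
    ((LinearMap.ker (bbl d a p q)).map (projOn d (windowSet (L : WithBot ℤ) ⊤)))
    (Fminus d a p q L)
  rw [← bulkSol_top_eq_sup hreg, (disjoint_map_projOn_ker_Fminus hreg L).eq_bot, finrank_bot,
    add_zero, ← LinearMap.range_domRestrict,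
    LinearMap.finrank_range_of_inj (injective_projOn_domRestrict_ker_bbl hreg L)] at hadd
  zify at hle hadd
  rw [Int.toNat_of_nonneg (by lia)] at hle
  linarith

lemma Fminus_le_suppIn {d : ℕ} {a : ℤ → Matrix (Fin d) (Fin d) ℂ} {p q : ℤ}
    (hreg : RowRegular d a p q) (L σ : ℤ) (hσ : σ = d * (max q 0 - min p 0)
        - Module.finrank ℂ ↥(LinearMap.ker (bbl d a p q))) :
    Fminus d a p q L ≤
      suppIn d (windowSet (L : WithBot ℤ) ((L + σ - 1 : ℤ) : WithTop ℤ)) := by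
  intro Ψ hΨ j hj
  have := finiteDimensional_bulkSol_top hreg L
  have : FiniteDimensional ℂ (Fminus d a p q L) :=
    Submodule.finiteDimensional_of_le (S₂ := bulkSol d a p q (L : WithBot ℤ) ⊤) inf_le_left
  have hle := finrank_Fminus_le hreg L
  rw [← hσ] at hle
  rw [mem_windowSet_coe, not_and_or, not_le, not_le] at hj
  rcases hj with hj | hj
  · exact ((mem_bulkSol_top ..).1 hΨ.1).1 j hj
  · set n := Module.finrank ℂ (Fminus d a p q L)
    let g : Module.End ℂ (Fminus d a p q L) := (rightShift d L).restrict rightShift_mem_Fminus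
    obtain ⟨k, hk⟩ := (mem_genKer ..).1 hΨ.2
    have hg : (⟨Ψ, hΨ⟩ : Fminus d a p q L) ∈ LinearMap.ker (g ^ k) := by
      rw [LinearMap.mem_ker, Module.End.pow_restrict]
      exact Subtype.ext hk
    have hgn := Module.End.ker_pow_le_ker_pow_finrank g k hg
    rw [LinearMap.mem_ker, Module.End.pow_restrict] at hgn
    have h0 := congrFun (congrArg Subtype.val hgn) (j - n)
    rw [LinearMap.coe_restrict_apply, rightShift_pow_apply d (by lia), sub_add_cancel] at h0
    exact h0

lemma map_reflect_suppIn (d : ℕ) (L R : ℤ) :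
    (suppIn d (windowSet ((-R : ℤ) : WithBot ℤ) ((-L : ℤ) : WithTop ℤ))).map
      (reflect d : SeqSp d →ₗ[ℂ] SeqSp d) =
      suppIn d (windowSet (L : WithBot ℤ) (R : WithTop ℤ)) := by
  ext Ψ
  rw [Submodule.mem_map_equiv, reflect_symm]
  change (∀ j ∉ _, reflect d Ψ j = 0) ↔ ∀ j ∉ _, Ψ j = 0
  simp only [mem_windowSet_coe, reflect_apply]
  refine ⟨fun h j hj => ?_, fun h j hj => h _ (by lia)⟩
  simpa using h (-j) (by lia)

theorem stmt_11 (d : ℕ) (hd : 1 ≤ d) (p q : ℤ) (hpq : p ≤ q)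
    (a : ℤ → Matrix (Fin d) (Fin d) ℂ) (hap : a p ≠ 0) (haq : a q ≠ 0)
    (hreg : (symbol d a p q).det ≠ 0)
    (σ : ℤ) (hσ : σ = d * (max q 0 - min p 0)
        - Module.finrank ℂ ↥(LinearMap.ker (bbl d a p q)))
    (L R : ℤ) :
    FiniteDimensional ℂ ↥(bulkSol d a p q (L : WithBot ℤ) ⊤) ∧
    (bulkSol d a p q (L : WithBot ℤ) ⊤
        = (LinearMap.ker (bbl d a p q)).map (projOn d (windowSet (L : WithBot ℤ) ⊤))
            ⊔ Fminus d a p q L) ∧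
    Disjoint ((LinearMap.ker (bbl d a p q)).map (projOn d (windowSet (L : WithBot ℤ) ⊤)))
      (Fminus d a p q L) ∧
    Fminus d a p q L ≤ suppIn d (windowSet (L : WithBot ℤ) ((L + σ - 1 : ℤ) : WithTop ℤ)) ∧
    FiniteDimensional ℂ ↥(bulkSol d a p q ⊥ (R : WithTop ℤ)) ∧
    (bulkSol d a p q ⊥ (R : WithTop ℤ)
        = (LinearMap.ker (bbl d a p q)).map (projOn d (windowSet ⊥ (R : WithTop ℤ)))
            ⊔ Fplus d a p q R) ∧
    Disjoint ((LinearMap.ker (bbl d a p q)).map (projOn d (windowSet ⊥ (R : WithTop ℤ))))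
      (Fplus d a p q R) ∧
    Fplus d a p q R ≤ suppIn d (windowSet ((R - σ + 1 : ℤ) : WithBot ℤ) (R : WithTop ℤ)) := by
  have hrow := rowRegular_of_det_ne_zero d a p q hreg
  refine ⟨finiteDimensional_bulkSol_top hrow L, bulkSol_top_eq_sup hrow L,
    disjoint_map_projOn_ker_Fminus hrow L, Fminus_le_suppIn hrow L σ hσ,
    finiteDimensional_bulkSol_bot hrow R, ?_, ?_, ?_⟩
  · rw [← map_reflect_bulkSol, bulkSol_top_eq_sup hrow.neg, Submodule.map_sup,
      map_reflect_map_projOn, map_reflect_ker, map_reflect_Fminus]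
  · rw [← map_reflect_Fminus, ← map_reflect_ker, ← map_reflect_map_projOn]
    exact Submodule.disjoint_map (reflect d).injective (disjoint_map_projOn_ker_Fminus hrow.neg _)
  · rw [← map_reflect_Fminus, ← map_reflect_suppIn]
    refine Submodule.map_mono ((Fminus_le_suppIn hrow.neg (-R) σ ?_).trans_eq ?_)
    · rw [hσ, ← map_reflect_ker, LinearEquiv.finrank_map_eq]
      congr 2
      lia
    · congr 3
      lia

end
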